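/- Let k > 0 and let C = {τ ∈ M³ˣ³_sym : ‖dev τ‖² ≤ 2k²} be the von Mises yield domain (i.e. J₂(τ) ≤ k²). Let σ ∈ M³ˣ³_sym with ‖dev σ‖² = 2k², and let λ > 0, μ > 0, H(τ) = 2μτ + λ tr(τ)I. Then for every ε̇ ∈ M³ˣ³_sym: P_{N_C(σ)}(ε̇) = (max(0, ε̇ : dev σ)/(2k²)) · dev σ, P_{T_C(σ)}(ε̇) = ε̇ − (max(0, ε̇ : dev σ)/(2k²)) · dev σ, and P_{T_C(σ)}(H(ε̇)) = λ tr(ε̇) I + 2μ ε̇ − (μ/k²) max(0, ε̇ : dev σ) · dev σ. -/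

import Mathlib

open Matrix

/-- The space of 3×3 real matrices (we single out the symmetric ones by `Matrix.IsSymm`). -/
abbrev Mat3 := Matrix (Fin 3) (Fin 3) ℝ

/-- The Frobenius inner product on symmetric matrices: `σ:τ = tr(στ)`. -/
noncomputable def minner (A B : Mat3) : ℝ := (A * B).trace

/-- The Frobenius norm `‖A‖ = (A:A)^{1/2}` on symmetric matrices. -/
noncomputable def mnorm (A : Mat3) : ℝ := Real.sqrt (minner A A)

/-- `p` is the metric (orthogonal) projection of `z` onto `K`. -/
def IsProjOn (K : Set Mat3) (z p : Mat3) : Prop :=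
  p ∈ K ∧ ∀ w ∈ K, mnorm (z - p) ≤ mnorm (z - w)

/-- The tangent cone of a convex set `C` at `σ`. -/
def tangentCone (C : Set Mat3) (σ : Mat3) : Set Mat3 :=
  closure {τ | ∃ η ∈ C, ∃ α : ℝ, 0 < α ∧ τ = α • (η - σ)}

/-- The normal cone of a convex set `C ⊆ M³ˣ³_sym` at `σ`. -/
def normalCone (C : Set Mat3) (σ : Mat3) : Set Mat3 :=
  {n | n.IsSymm ∧ ∀ τ ∈ tangentCone C σ, minner n τ ≤ 0}

/-- The Hooke (isotropic elasticity) operator `H(τ) = 2μτ + λ tr(τ) I`. -/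
noncomputable def hooke (lam mu : ℝ) (τ : Mat3) : Mat3 :=
  (2 * mu) • τ + (lam * τ.trace) • (1 : Mat3)

/-- The deviatoric part of a matrix: `dev σ = σ - (tr σ / 3) I`. -/
noncomputable def dev (τ : Mat3) : Mat3 := τ - (τ.trace / 3) • (1 : Mat3)

theorem minner_comm (A B : Mat3) : minner A B = minner B A := trace_mul_comm A B

theorem minner_add_left (A B D : Mat3) : minner (A + B) D = minner A D + minner B D := by
  simp [minner, add_mul]

theorem minner_smul_left (c : ℝ) (A D : Mat3) : minner (c • A) D = c * minner A D := by
  simp [minner]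

theorem minner_sub_left (A B D : Mat3) : minner (A - B) D = minner A D - minner B D := by
  simp [minner, sub_mul]

theorem minner_add_right (A B D : Mat3) : minner D (A + B) = minner D A + minner D B := by
  simp [minner, mul_add]

theorem minner_smul_right (c : ℝ) (A D : Mat3) : minner D (c • A) = c * minner D A := by
  simp [minner]

theorem minner_sub_right (A B D : Mat3) : minner D (A - B) = minner D A - minner D B := by
  simp [minner, mul_sub]

theorem minner_self_nonneg {A : Mat3} (hA : A.IsSymm) : 0 ≤ minner A A := by
  have h : minner A A = (A * Aᵀ).trace := by rw [hA.eq]; rfl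
  rw [h]
  simp only [trace, diag_apply, mul_apply, transpose_apply]
  exact Finset.sum_nonneg fun i _ => Finset.sum_nonneg fun j _ => mul_self_nonneg _

theorem mnorm_sq {A : Mat3} (hA : A.IsSymm) : mnorm A ^ 2 = minner A A :=
  Real.sq_sqrt (minner_self_nonneg hA)

theorem mnorm_le {A B : Mat3} (h : minner A A ≤ minner B B) : mnorm A ≤ mnorm B :=
  Real.sqrt_le_sqrt h

theorem symm_smul {A : Mat3} (c : ℝ) (hA : A.IsSymm) : (c • A).IsSymm := by
  simp [IsSymm, hA.eq]

theorem symm_sub {A B : Mat3} (hA : A.IsSymm) (hB : B.IsSymm) : (A - B).IsSymm := by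
  simp [IsSymm, hA.eq, hB.eq]

theorem symm_add {A B : Mat3} (hA : A.IsSymm) (hB : B.IsSymm) : (A + B).IsSymm := by
  simp [IsSymm, hA.eq, hB.eq]

theorem symm_dev {A : Mat3} (hA : A.IsSymm) : (dev A).IsSymm :=
  symm_sub hA (symm_smul _ isSymm_one)

theorem minner_one_dev (A : Mat3) : minner 1 (dev A) = 0 := by
  simp [minner, dev]

theorem minner_dev_left (A B : Mat3) : minner (dev A) (dev B) = minner A (dev B) := by
  have h : dev A = A - (A.trace / 3) • (1 : Mat3) := rfl
  rw [h, minner_sub_left, minner_smul_left, minner_one_dev]; ring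

theorem dev_add_smul (A B : Mat3) (t : ℝ) : dev (A + t • B) = dev A + t • dev B := by
  simp only [dev, trace_add, trace_smul, smul_eq_mul, smul_sub, smul_smul]
  module

/-- The tangent cone at a point of the yield surface is a half-space. -/
theorem mem_tangent_iff (k : ℝ) (hk : 0 < k) (σ : Mat3) (hσsym : σ.IsSymm)
    (hσ : minner (dev σ) (dev σ) = 2 * k ^ 2) (τ : Mat3) :
    τ ∈ tangentCone {τ : Mat3 | τ.IsSymm ∧ mnorm (dev τ) ^ 2 ≤ 2 * k ^ 2} σ ↔
      τ.IsSymm ∧ minner τ (dev σ) ≤ 0 := by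
  have hDs := symm_dev hσsym
  constructor
  · intro h
    have hcl : IsClosed {τ : Mat3 | τ.IsSymm ∧ minner τ (dev σ) ≤ 0} := by
      apply IsClosed.and
      · exact isClosed_eq (by fun_prop) continuous_id
      · apply isClosed_le _ continuous_const
        unfold minner
        fun_prop
    refine closure_minimal ?_ hcl h
    rintro _ ⟨η, ⟨hη, hη2⟩, α, hα, rfl⟩
    refine ⟨symm_smul _ (symm_sub hη hσsym), ?_⟩
    have hE := symm_dev hη
    rw [mnorm_sq hE] at hη2
    have h0 := minner_self_nonneg (symm_sub hE hDs)
    rw [minner_sub_left, minner_sub_right, minner_sub_right, minner_comm (dev σ) (dev η),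
      minner_dev_left η σ] at h0
    rw [minner_smul_left, minner_sub_left, ← minner_dev_left σ σ]
    exact mul_nonpos_of_nonneg_of_nonpos hα.le (by linarith)
  · rintro ⟨hs, hle⟩
    have key : ∀ ρ : Mat3, ρ.IsSymm → minner ρ (dev σ) < 0 →
        ρ ∈ {τ : Mat3 | ∃ η ∈ {τ : Mat3 | τ.IsSymm ∧ mnorm (dev τ) ^ 2 ≤ 2 * k ^ 2},
          ∃ α : ℝ, 0 < α ∧ τ = α • (η - σ)} := by
      intro ρ hρ hneg
      have hq := minner_self_nonneg (symm_dev hρ)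
      set q := minner (dev ρ) (dev ρ) with hqd
      set b := minner ρ (dev σ) with hb
      have hq1 : 0 < q + 1 := by linarith
      have ht : 0 < -b / (q + 1) := div_pos (by linarith) hq1
      set t := -b / (q + 1) with htd
      have htq : t * (q + 1) = -b := div_mul_cancel₀ _ hq1.ne'
      have hsy : (σ + t • ρ).IsSymm := symm_add hσsym (symm_smul _ hρ)
      refine ⟨σ + t • ρ, ⟨hsy, ?_⟩, t⁻¹, inv_pos.2 ht, ?_⟩
      · rw [mnorm_sq (symm_dev hsy), dev_add_smul]
        simp only [minner_add_left, minner_add_right, minner_smul_left, minner_smul_right]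
        rw [minner_comm (dev σ) (dev ρ), minner_dev_left ρ σ, hσ, ← hqd, ← hb]
        nlinarith [mul_pos ht ht]
      · rw [add_sub_cancel_left, smul_smul, inv_mul_cancel₀ ht.ne', one_smul]
    have hlim : Filter.Tendsto (fun e : ℝ => τ - e • dev σ) (nhdsWithin 0 (Set.Ioi 0))
        (nhds τ) := by
      have hc : Continuous (fun e : ℝ => τ - e • dev σ) := by fun_prop
      have := hc.tendsto 0
      simp only [zero_smul, sub_zero] at this
      exact this.mono_left nhdsWithin_le_nhds
    refine mem_closure_of_tendsto hlim ?_
    filter_upwards [self_mem_nhdsWithin] with e he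
    refine key _ (symm_sub hs (symm_smul _ hDs)) ?_
    rw [minner_sub_left, minner_smul_left, hσ]
    have : 0 < e * (2 * k ^ 2) := mul_pos he (by positivity)
    linarith

/-- Von Mises criterion: explicit projections on the normal and tangent cones and the
explicit constitutive law at a stress `σ` on the yield surface `‖dev σ‖² = 2k²`. -/
theorem stmt12 (k : ℝ) (hk : 0 < k)
    (C : Set Mat3) (hC : C = {τ : Mat3 | τ.IsSymm ∧ mnorm (dev τ) ^ 2 ≤ 2 * k ^ 2})
    (σ : Mat3) (hσsym : σ.IsSymm) (hσ : mnorm (dev σ) ^ 2 = 2 * k ^ 2)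
    (lam mu : ℝ) (hlam : 0 < lam) (hmu : 0 < mu) :
    ∀ ε' : Mat3, ε'.IsSymm →
      IsProjOn (normalCone C σ) ε' ((max 0 (minner ε' (dev σ)) / (2 * k ^ 2)) • dev σ) ∧
      IsProjOn (tangentCone C σ) ε'
        (ε' - (max 0 (minner ε' (dev σ)) / (2 * k ^ 2)) • dev σ) ∧
      IsProjOn (tangentCone C σ) (hooke lam mu ε')
        ((lam * ε'.trace) • (1 : Mat3) + (2 * mu) • ε' -
          (mu / k ^ 2 * max 0 (minner ε' (dev σ))) • dev σ) := by
  subst hC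
  have hDs := symm_dev hσsym
  rw [mnorm_sq hDs] at hσ
  have hT := mem_tangent_iff k hk σ hσsym hσ
  have hk2 : 0 < 2 * k ^ 2 := by positivity
  -- facts about the decomposition
  have facts : ∀ z : Mat3, z.IsSymm → ∀ c : ℝ, c = max 0 (minner z (dev σ)) / (2 * k ^ 2) →
      0 ≤ c ∧ minner (z - c • dev σ) (dev σ) ≤ 0 ∧ c * minner (z - c • dev σ) (dev σ) = 0 := by
    intro z _ c hc
    have hcm : c * (2 * k ^ 2) = max 0 (minner z (dev σ)) := by
      rw [hc]; exact div_mul_cancel₀ _ hk2.ne'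
    rw [minner_sub_left, minner_smul_left, hσ, hcm]
    refine ⟨by rw [hc]; positivity, by linarith [le_max_right 0 (minner z (dev σ))], ?_⟩
    rcases le_total 0 (minner z (dev σ)) with h | h
    · rw [max_eq_right h]; ring
    · rw [max_eq_left h] at hc
      rw [hc]; simp
  have tang : ∀ z : Mat3, z.IsSymm → IsProjOn
      (tangentCone {τ : Mat3 | τ.IsSymm ∧ mnorm (dev τ) ^ 2 ≤ 2 * k ^ 2} σ) z
        (z - (max 0 (minner z (dev σ)) / (2 * k ^ 2)) • dev σ) := by
    intro z hz
    obtain ⟨c, hc⟩ : ∃ c, c = max 0 (minner z (dev σ)) / (2 * k ^ 2) := ⟨_, rfl⟩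
    obtain ⟨h0, h1, h2⟩ := facts z hz c hc
    rw [← hc]
    have hp : (z - c • dev σ).IsSymm := symm_sub hz (symm_smul _ hDs)
    refine ⟨(hT _).2 ⟨hp, h1⟩, fun w hw => mnorm_le ?_⟩
    obtain ⟨hws, hw1⟩ := (hT w).1 hw
    generalize hpd : z - c • dev σ = p at *
    have hzp : z = p + c • dev σ := by rw [← hpd]; abel
    have e1 : z - p = c • dev σ := by rw [hzp]; abel
    have e2 : z - w = c • dev σ + (p - w) := by rw [hzp]; abel
    have hn := minner_self_nonneg (symm_sub hp hws)
    have hcw := mul_nonpos_of_nonneg_of_nonpos h0 hw1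
    rw [e1, e2, minner_add_left, minner_add_right, minner_add_right,
      minner_comm (p - w) (c • dev σ)]
    have : minner (c • dev σ) (p - w) = c * minner p (dev σ) - c * minner w (dev σ) := by
      rw [minner_smul_left, minner_comm, minner_sub_left]; ring
    rw [this]
    linarith
  intro z hz
  refine ⟨?_, tang z hz, ?_⟩
  · obtain ⟨c, hc⟩ : ∃ c, c = max 0 (minner z (dev σ)) / (2 * k ^ 2) := ⟨_, rfl⟩
    obtain ⟨h0, h1, h2⟩ := facts z hz c hc
    rw [← hc]
    have hcs := symm_smul c hDs
    have hp : (z - c • dev σ).IsSymm := symm_sub hz hcs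
    refine ⟨⟨hcs, fun τ hτ => ?_⟩, fun w hw => mnorm_le ?_⟩
    · rw [minner_smul_left, minner_comm]
      exact mul_nonpos_of_nonneg_of_nonpos h0 ((hT τ).1 hτ).2
    · obtain ⟨hws, hw1⟩ := hw
      have hwp := hw1 _ ((hT _).2 ⟨hp, h1⟩)
      generalize hpd : z - c • dev σ = p at *
      have hzp : z = p + c • dev σ := by rw [← hpd]; abel
      have e2 : z - w = p + (c • dev σ - w) := by rw [hzp]; abel
      have hn := minner_self_nonneg (symm_sub hcs hws)
      rw [e2, minner_add_left p, minner_add_right, minner_add_right p,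
        minner_comm (c • dev σ - w) p]
      have : minner p (c • dev σ - w) = c * minner p (dev σ) - minner w p := by
        rw [minner_sub_right, minner_smul_right, minner_comm p w]
      rw [this]
      linarith
  · have hh : (hooke lam mu z).IsSymm :=
      symm_add (symm_smul _ hz) (symm_smul _ isSymm_one)
    have h := tang _ hh
    have hm : minner (hooke lam mu z) (dev σ) = 2 * mu * minner z (dev σ) := by
      rw [hooke, minner_add_left, minner_smul_left, minner_smul_left, minner_one_dev]; ring
    have hmax : max 0 (2 * mu * minner z (dev σ)) = 2 * mu * max 0 (minner z (dev σ)) := by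
      rw [mul_max_of_nonneg _ _ (by positivity), mul_zero]
    have hcoef : 2 * mu * max 0 (minner z (dev σ)) / (2 * k ^ 2) =
        mu / k ^ 2 * max 0 (minner z (dev σ)) := by
      field_simp
    rw [hm, hmax, hcoef] at h
    have e : (lam * z.trace) • (1 : Mat3) + (2 * mu) • z -
        (mu / k ^ 2 * max 0 (minner z (dev σ))) • dev σ = hooke lam mu z -
        (mu / k ^ 2 * max 0 (minner z (dev σ))) • dev σ := by
      rw [hooke, add_comm]
    rw [e]
    exact h
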